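/- arXiv:2407.20124 — 3 statements merged into one kernel-verified Lean document; each statement's English description precedes it below -/
import Mathlib

section
/- Let d ≥ 1, ζ ≥ 1, and let x_1, …, x_T ∈ ℝ^d satisfy ‖x_t‖₂ ≤ 1 for all t. Define M_t = ζ I_d + Σ_{s=1}^{t} x_s x_sᵀ for t ≥ 0 (so M_0 = ζ I_d). Then Σ_{t=1}^{T} min{1, x_tᵀ M_{t-1}^{-1} x_t} ≤ 2 d log(1 + T/(ζ d)). -/
open Matrix

theorem Real.min_one_le_two_mul_log_one_add {u : ℝ} (hu : 0 ≤ u) :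
    min 1 u ≤ 2 * Real.log (1 + u) := by
  set m := min 1 u
  have hm0 : 0 ≤ m := le_min zero_le_one hu
  have hm1 : m ≤ 1 := min_le_left _ _
  have hlog := Real.one_sub_inv_le_log_of_pos (show 0 < 1 + m by linarith)
  have hmono : Real.log (1 + m) ≤ Real.log (1 + u) :=
    Real.log_le_log (by linarith) (by linarith [min_le_right 1 u])
  have hhalf : m / 2 ≤ 1 - (1 + m)⁻¹ := by
    have : 1 - (1 + m)⁻¹ = m / (1 + m) := by field_simp; ring
    rw [this]
    gcongr
    linarith
  linarith

namespace Matrix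

variable {n : Type*} [Fintype n] [DecidableEq n]

theorem det_add_vecMulVec {R : Type*} [CommRing R] {A : Matrix n n R} (hA : IsUnit A.det)
    (u v : n → R) : (A + vecMulVec u v).det = A.det * (1 + v ⬝ᵥ (A⁻¹ *ᵥ u)) := by
  rw [vecMulVec_eq Unit, det_add_replicateCol_mul_replicateRow hA, Matrix.mul_assoc,
    ← replicateCol_mulVec, det_unique (n := Unit)]
  simp [Matrix.mul_apply, dotProduct]

theorem PosDef.log_det_le {A : Matrix n n ℝ} (hA : A.PosDef) {a : ℝ} (ha : 0 < a) :
    Real.log A.det ≤ Fintype.card n * (Real.log a - 1) + A.trace / a := by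
  have hdet := hA.isHermitian.det_eq_prod_eigenvalues
  have htr := hA.isHermitian.trace_eq_sum_eigenvalues
  simp only [RCLike.ofReal_real_eq_id, id_eq] at hdet htr
  rw [hdet, htr, Real.log_prod fun i _ => (hA.eigenvalues_pos i).ne', Finset.sum_div,
    ← nsmul_eq_mul, ← Finset.card_univ, ← Finset.sum_const, ← Finset.sum_add_distrib]
  refine Finset.sum_le_sum fun i _ => ?_
  have hpos := hA.eigenvalues_pos i
  have := Real.log_le_sub_one_of_pos (div_pos hpos ha)
  rw [Real.log_div hpos.ne' ha.ne'] at this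
  linarith

end Matrix

/-- Elliptical potential lemma (Lemma 11 of Abbasi-Yadkori et al.):
with `M_t = ζ I + ∑_{s ≤ t} x_s x_sᵀ` and `‖x_t‖₂ ≤ 1`, `ζ ≥ 1`,
`∑_{t=1}^T min{1, x_tᵀ M_{t-1}⁻¹ x_t} ≤ 2 d log (1 + T/(ζ d))`. -/
theorem elliptical_potential {d T : ℕ} (hd : 1 ≤ d) (ζ : ℝ) (hζ : 1 ≤ ζ)
    (x : ℕ → Fin d → ℝ)
    (hx : ∀ t, Real.sqrt (∑ i, x t i ^ 2) ≤ 1)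
    (M : ℕ → Matrix (Fin d) (Fin d) ℝ)
    (hM : ∀ t, M t = ζ • (1 : Matrix (Fin d) (Fin d) ℝ)
        + ∑ s ∈ Finset.Icc 1 t, Matrix.vecMulVec (x s) (x s)) :
    ∑ t ∈ Finset.Icc 1 T, min 1 (x t ⬝ᵥ ((M (t - 1))⁻¹ *ᵥ x t))
      ≤ 2 * d * Real.log (1 + (T : ℝ) / (ζ * d)) := by
  have hd0 : (0 : ℝ) < d := by exact_mod_cast hd
  have hζ0 : 0 < ζ := by linarith
  have hxx : ∀ t, x t ⬝ᵥ x t ≤ 1 := fun t => by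
    simpa [dotProduct, sq] using Real.sqrt_le_one.mp (hx t)
  have hpos : ∀ t, (M t).PosDef := fun t => by
    rw [hM]
    refine (PosDef.one.smul hζ0).add_posSemidef ?_
    exact posSemidef_sum _ fun s _ => posSemidef_vecMulVec_self_star (x s)
  have hsucc : ∀ t, M (t + 1) = M t + vecMulVec (x (t + 1)) (x (t + 1)) := fun t => by
    rw [hM, hM, Finset.sum_Icc_succ_top (by omega), add_assoc]
  have hsum : ∀ N : ℕ, ∑ t ∈ Finset.Icc 1 N, min 1 (x t ⬝ᵥ ((M (t - 1))⁻¹ *ᵥ x t))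
      ≤ 2 * (Real.log (M N).det - Real.log (M 0).det) := fun N => by
    induction N with
    | zero => simp
    | succ k ih =>
      rw [Finset.sum_Icc_succ_top (by omega), Nat.add_sub_cancel, hsucc,
        det_add_vecMulVec (hpos k).det_pos.ne'.isUnit]
      have hu : 0 ≤ x (k + 1) ⬝ᵥ ((M k)⁻¹ *ᵥ x (k + 1)) := by
        simpa using (hpos k).inv.posSemidef.dotProduct_mulVec_nonneg (x (k + 1))
      rw [Real.log_mul (hpos k).det_pos.ne' (by positivity)]
      linarith [Real.min_one_le_two_mul_log_one_add hu]
  have hlog0 : Real.log (M 0).det = d * Real.log ζ := by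
    simp [hM]
  have htr : (M T).trace ≤ d * ζ + T := by
    rw [hM, trace_add, trace_smul, trace_one, trace_sum]
    have := Finset.sum_le_card_nsmul (Finset.Icc 1 T) (fun s => (vecMulVec (x s) (x s)).trace) 1
      fun s _ => by simpa only [trace_vecMulVec] using hxx s
    simp only [Nat.card_Icc, Nat.add_sub_cancel, nsmul_eq_mul, mul_one] at this
    simp only [Fintype.card_fin, smul_eq_mul]
    linarith
  set a : ℝ := ζ + T / d with ha_def
  have ha : 0 < a := by positivity
  have hda : d * ζ + T = d * a := by rw [ha_def]; field_simp
  have hlogT := (hpos T).log_det_le ha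
  have hquot : (M T).trace / a ≤ d := by rw [div_le_iff₀ ha]; linarith
  have hratio : Real.log (1 + (T : ℝ) / (ζ * d)) = Real.log a - Real.log ζ := by
    rw [← Real.log_div ha.ne' hζ0.ne', ha_def]
    congr 1
    field_simp
  rw [Fintype.card_fin] at hlogT
  rw [hratio]
  linarith [hsum T]
end

section
/- Let M be a d×d real symmetric positive definite matrix, let G be a d×d real symmetric matrix, and let m > 0 be such that G − m M is positive semidefinite. Then for every v ∈ ℝ^d, m² (vᵀ M v) ≤ (G v)ᵀ M^{-1} (G v). -/
open Matrix

/-- If `M` is symmetric positive definite, `G` symmetric, `m > 0`, and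
`G - m M` is positive semidefinite, then `m² vᵀ M v ≤ (G v)ᵀ M⁻¹ (G v)` for all `v`. -/
theorem strong_monotonicity_transfer {d : ℕ}
    (M G : Matrix (Fin d) (Fin d) ℝ) (hM : M.PosDef) (hG : G.IsHermitian)
    (m : ℝ) (hm : 0 < m) (hGM : (G - m • M).PosSemidef) :
    ∀ v : Fin d → ℝ,
      m ^ 2 * (v ⬝ᵥ (M *ᵥ v)) ≤ (G *ᵥ v) ⬝ᵥ (M⁻¹ *ᵥ (G *ᵥ v)) := by
  intro v
  have hMt : Mᵀ = M := by simpa using hM.isHermitian.eq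
  have hdet : IsUnit M.det := M.isUnit_iff_isUnit_det.mp hM.isUnit
  obtain ⟨w, hw⟩ : ∃ w, w = (G - m • M) *ᵥ v := ⟨_, rfl⟩
  have hGv : G *ᵥ v = w + m • (M *ᵥ v) := by
    rw [hw, sub_mulVec, smul_mulVec, sub_add_cancel]
  have hInv : M⁻¹ *ᵥ (M *ᵥ v) = v := by
    rw [mulVec_mulVec, nonsing_inv_mul M hdet, one_mulVec]
  have hcross : (M *ᵥ v) ⬝ᵥ (M⁻¹ *ᵥ w) = w ⬝ᵥ v := by
    rw [← vecMul_transpose, hMt, ← dotProduct_mulVec, mulVec_mulVec, mul_nonsing_inv M hdet,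
      one_mulVec, dotProduct_comm]
  have hvw : 0 ≤ w ⬝ᵥ v := by
    rw [dotProduct_comm, hw]
    simpa using hGM.dotProduct_mulVec_nonneg v
  have hww : 0 ≤ w ⬝ᵥ (M⁻¹ *ᵥ w) := by
    simpa using hM.inv.posSemidef.dotProduct_mulVec_nonneg w
  rw [hGv, mulVec_add, mulVec_smul, hInv]
  simp only [add_dotProduct, dotProduct_add, smul_dotProduct, dotProduct_smul, smul_eq_mul, hcross]
  rw [dotProduct_comm (M *ᵥ v) v]
  nlinarith [mul_nonneg hm.le hvw]
end

section
/- Let M be a d×d real symmetric positive definite matrix, let 𝒜 be a finite nonempty set of arms, each arm a ∈ 𝒜 having a feature vector x_a ∈ ℝ^d, and let θ, θ̂ ∈ ℝ^d and α ≥ 0 be such that |x_aᵀ(θ̂ − θ)| ≤ α ‖x_a‖_{M^{-1}} for every a ∈ 𝒜. Suppose â ∈ 𝒜 maximizes a ↦ x_aᵀ θ̂ + α ‖x_a‖_{M^{-1}} over 𝒜 and a* ∈ 𝒜 maximizes a ↦ x_aᵀ θ over 𝒜. Then x_{a*}ᵀ θ − x_{â}ᵀ θ ≤ 2α ‖x_{â}‖_{M^{-1}};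 consequently, for any nondecreasing L-Lipschitz function μ : ℝ → ℝ, μ(x_{a*}ᵀ θ) − μ(x_{â}ᵀ θ) ≤ 2 α L ‖x_{â}‖_{M^{-1}}. -/
open Matrix

/-- Instantaneous regret bound for the optimistic (UCB) arm selection rule:
if all confidence bounds `|x_aᵀ(θ̂ - θ)| ≤ α ‖x_a‖_{M⁻¹}` hold, `â` maximizes the
upper confidence index and `a*` maximizes the true payoff, then
`x_{a*}ᵀ θ - x_{â}ᵀ θ ≤ 2α ‖x_{â}‖_{M⁻¹}`, and consequently for any nondecreasing
`L`-Lipschitz link `μ`, `μ(x_{a*}ᵀ θ) - μ(x_{â}ᵀ θ) ≤ 2αL ‖x_{â}‖_{M⁻¹}`. -/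
theorem ucb_instantaneous_regret {d : ℕ} {ι : Type*} [Fintype ι] [Nonempty ι]
    (M : Matrix (Fin d) (Fin d) ℝ) (hM : M.PosDef)
    (x : ι → Fin d → ℝ) (θ θhat : Fin d → ℝ) (α : ℝ) (hα : 0 ≤ α)
    (hconf : ∀ a, |x a ⬝ᵥ (θhat - θ)| ≤ α * Real.sqrt (x a ⬝ᵥ (M⁻¹ *ᵥ x a)))
    (ahat astar : ι)
    (hahat : ∀ a, x a ⬝ᵥ θhat + α * Real.sqrt (x a ⬝ᵥ (M⁻¹ *ᵥ x a))
      ≤ x ahat ⬝ᵥ θhat + α * Real.sqrt (x ahat ⬝ᵥ (M⁻¹ *ᵥ x ahat)))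
    (hastar : ∀ a, x a ⬝ᵥ θ ≤ x astar ⬝ᵥ θ) :
    x astar ⬝ᵥ θ - x ahat ⬝ᵥ θ ≤ 2 * α * Real.sqrt (x ahat ⬝ᵥ (M⁻¹ *ᵥ x ahat)) ∧
    ∀ (L : ℝ) (μ : ℝ → ℝ), Monotone μ → (∀ a b : ℝ, |μ a - μ b| ≤ L * |a - b|) →
      μ (x astar ⬝ᵥ θ) - μ (x ahat ⬝ᵥ θ)
        ≤ 2 * α * L * Real.sqrt (x ahat ⬝ᵥ (M⁻¹ *ᵥ x ahat)) := by
  have hlin : x astar ⬝ᵥ θ - x ahat ⬝ᵥ θ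
      ≤ 2 * α * Real.sqrt (x ahat ⬝ᵥ (M⁻¹ *ᵥ x ahat)) := by
    have hstar := (abs_le.mp (hconf astar)).1
    have hhat := (abs_le.mp (hconf ahat)).2
    rw [dotProduct_sub] at hstar hhat
    linarith [hahat astar]
  refine ⟨hlin, fun L μ _ hLip => ?_⟩
  have hL : 0 ≤ L := by
    simpa using (abs_nonneg _).trans (hLip 1 0)
  calc μ (x astar ⬝ᵥ θ) - μ (x ahat ⬝ᵥ θ)
      ≤ L * |x astar ⬝ᵥ θ - x ahat ⬝ᵥ θ| := (le_abs_self _).trans (hLip _ _)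
    _ = L * (x astar ⬝ᵥ θ - x ahat ⬝ᵥ θ) := by
        rw [abs_of_nonneg (sub_nonneg.mpr (hastar ahat))]
    _ ≤ L * (2 * α * Real.sqrt (x ahat ⬝ᵥ (M⁻¹ *ᵥ x ahat))) :=
        mul_le_mul_of_nonneg_left hlin hL
    _ = 2 * α * L * Real.sqrt (x ahat ⬝ᵥ (M⁻¹ *ᵥ x ahat)) := by ring
end
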